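/- Let D > 0, and assume the reproduction alphabet has been reduced to 𝒴*(D), so that every minimizer P_{XY} of R(D) satisfies P_{XY}(x,y) > 0 for all (x,y) ∈ 𝒳×𝒴*(D). Then for any good sequence of (n,R_n) rate-distortion codes for distortion D, it holds that lim_{n→∞} (1/n) D(P_{X^nY^n} ‖ Q_{X^nY^n}) = 0, where P_{X^nY^n}(x^n,y^n) = ∏_{i=1}^n P_X(x_i) · 1{y^n = g_n(f_n(x^n))} and Q_{X^nY^n}(x^n,y^n) = (|g_n^{-1}(y^n)|/M) · ∏_{i=1}^n P_{X|Y}(x_i|y_i), with P_{X|Y} the unique backward channel corresponding to D. -/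

import Mathlib

open scoped BigOperators ENNReal Classical
open Filter

section InformationDefs

variable {α X Y : Type*}

/-- A probability mass function on a finite alphabet. -/
def IsPMF [Fintype α] (P : α → ℝ) : Prop :=
  (∀ a, 0 ≤ P a) ∧ ∑ a, P a = 1

/-- Variational distance `‖P − Q‖ = sup_A |P(A) − Q(A)|` on a finite alphabet. -/
noncomputable def tvDist [Fintype α] (P Q : α → ℝ) : ℝ :=
  Finset.univ.powerset.sup' ⟨∅, Finset.empty_mem_powerset _⟩
    fun A => |∑ a ∈ A, P a - ∑ a ∈ A, Q a|

/-- Relative entropy `D(P‖Q) = ∑ P log(P/Q)` on a finite alphabet, infinite when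
`P` is not absolutely continuous with respect to `Q`. -/
noncomputable def relEnt [Fintype α] (P Q : α → ℝ) : ℝ≥0∞ :=
  if ∀ a, Q a = 0 → P a = 0 then
    ENNReal.ofReal (∑ a, P a * Real.log (P a / Q a))
  else ⊤

/-- Shannon entropy on a finite alphabet. -/
noncomputable def entropy [Fintype α] (P : α → ℝ) : ℝ :=
  -∑ a, P a * Real.log (P a)

/-- First (X-) marginal of a joint distribution. -/
noncomputable def margX [Fintype Y] (P : X × Y → ℝ) : X → ℝ :=
  fun x => ∑ y, P (x, y)

/-- Second (Y-) marginal of a joint distribution. -/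
noncomputable def margY [Fintype X] (P : X × Y → ℝ) : Y → ℝ :=
  fun y => ∑ x, P (x, y)

/-- Backward conditional distribution `P_{X|Y}(x|y) = P(x,y)/P_Y(y)`. -/
noncomputable def condXY [Fintype X] (P : X × Y → ℝ) : X → Y → ℝ :=
  fun x y => P (x, y) / margY P y

/-- Forward conditional distribution `P_{Y|X}(y|x) = P(x,y)/P_X(x)`. -/
noncomputable def condYX [Fintype Y] (P : X × Y → ℝ) : Y → X → ℝ :=
  fun y x => P (x, y) / margX P x

/-- Mutual information `I(X;Y)` of a joint distribution on a finite product alphabet. -/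
noncomputable def mutualInfo [Fintype X] [Fintype Y] (P : X × Y → ℝ) : ℝ :=
  ∑ x, ∑ y, P (x, y) * Real.log (P (x, y) / (margX P x * margY P y))

/-- A block code of length `n`: an encoder into `{1,…,M}` and a decoder. -/
structure Code (X Y : Type*) (n : ℕ) where
  M : ℕ
  hM : 0 < M
  enc : (Fin n → X) → Fin M
  dec : Fin M → Fin n → Y

/-- Rate `R_n = (1/n) log M` of a code. -/
noncomputable def Code.rate {X Y : Type*} {n : ℕ} (c : Code X Y n) : ℝ :=
  Real.log c.M / n

/-- The reconstruction sequence `Yⁿ = g_n(f_n(xⁿ))` produced by a code. -/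
def Code.out {X Y : Type*} {n : ℕ} (c : Code X Y n) (xs : Fin n → X) : Fin n → Y :=
  c.dec (c.enc xs)

/-- The i.i.d. (memoryless) source distribution on `n`-blocks. -/
noncomputable def iid (PX : X → ℝ) (n : ℕ) : (Fin n → X) → ℝ :=
  fun xs => ∏ i, PX (xs i)

/-- The code-induced joint distribution
`P_{XⁿYⁿ}(xⁿ,yⁿ) = ∏ P_X(x_i) · 1{yⁿ = g_n(f_n(xⁿ))}`. -/
noncomputable def inducedJoint [DecidableEq Y] (PX : X → ℝ) {n : ℕ} (c : Code X Y n) :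
    (Fin n → X) × (Fin n → Y) → ℝ :=
  fun p => (∏ i, PX (p.1 i)) * (if p.2 = c.out p.1 then 1 else 0)

/-- The approximating joint distribution
`Q_{XⁿYⁿ}(xⁿ,yⁿ) = (|g_n⁻¹(yⁿ)|/M) · ∏ P_{X|Y}(x_i|y_i)`:
a uniformly chosen codeword passed through the backward memoryless channel. -/
noncomputable def approxJoint [Fintype X] [DecidableEq Y] (PXY : X × Y → ℝ) {n : ℕ}
    (c : Code X Y n) : (Fin n → X) × (Fin n → Y) → ℝ :=
  fun p => (((Finset.univ.filter fun m => c.dec m = p.2).card : ℝ) / c.M) *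
    ∏ i, condXY PXY (p.1 i) (p.2 i)

/-- The uniform distribution over the codebook, `Q_{Yⁿ}(yⁿ) = |g_n⁻¹(yⁿ)|/M`. -/
noncomputable def codebookUniform [DecidableEq Y] {n : ℕ} (c : Code X Y n) :
    (Fin n → Y) → ℝ :=
  fun ys => ((Finset.univ.filter fun m => c.dec m = ys).card : ℝ) / c.M

/-- The empirical (joint type) distribution of a pair of sequences. -/
noncomputable def empDist [DecidableEq X] [DecidableEq Y] {n : ℕ}
    (xs : Fin n → X) (ys : Fin n → Y) : X × Y → ℝ :=
  fun p => ((Finset.univ.filter fun i => xs i = p.1 ∧ ys i = p.2).card : ℝ) / n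

/-- `‖T_{XⁿYⁿ} − P_{XY}‖ → 0` in probability under the i.i.d. source. -/
def TVInProb [Fintype X] [Fintype Y] [DecidableEq X] [DecidableEq Y]
    (PX : X → ℝ) (PXY : X × Y → ℝ) (c : ∀ n, Code X Y n) : Prop :=
  ∀ ε : ℝ, 0 < ε →
    Tendsto (fun n => ∑ xs : Fin n → X,
        if ε < tvDist (empDist xs ((c n).out xs)) PXY then iid PX n xs else 0)
      atTop (nhds 0)

/-- A good sequence of coordination codes for `P_{Y|X}` (specified via the joint `PXY`):
the rates converge to `I(X;Y)` and the empirical distribution converges to `PXY`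
in variational distance, in probability. -/
def GoodCoord [Fintype X] [Fintype Y] [DecidableEq X] [DecidableEq Y]
    (PX : X → ℝ) (PXY : X × Y → ℝ) (c : ∀ n, Code X Y n) : Prop :=
  Tendsto (fun n => (c n).rate) atTop (nhds (mutualInfo PXY)) ∧ TVInProb PX PXY c

end InformationDefs
section RateDistortionDefs

variable {X Y : Type*}

/-- Expected per-letter distortion `E d(X,Y)` of a joint distribution. -/
noncomputable def expDist [Fintype X] [Fintype Y] (P : X × Y → ℝ) (d : X → Y → ℝ) : ℝ :=
  ∑ x, ∑ y, P (x, y) * d x y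

/-- The rate-distortion function `R(D) = min I(X;Y)` over joint distributions with
`X`-marginal `PX` and expected distortion at most `D`. -/
noncomputable def RD [Fintype X] [Fintype Y] (PX : X → ℝ) (d : X → Y → ℝ) (D : ℝ) : ℝ :=
  sInf {r | ∃ P : X × Y → ℝ,
    IsPMF P ∧ margX P = PX ∧ expDist P d ≤ D ∧ r = mutualInfo P}

/-- `P` is a minimizer of the rate-distortion function at distortion level `D`. -/
def IsRDMinimizer [Fintype X] [Fintype Y] (PX : X → ℝ) (d : X → Y → ℝ) (D : ℝ)
    (P : X × Y → ℝ) : Prop :=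
  IsPMF P ∧ margX P = PX ∧ expDist P d ≤ D ∧ mutualInfo P = RD PX d D

/-- Average per-letter expected distortion `(1/n) ∑ᵢ E d(Xᵢ,Yᵢ)` of a code on the
i.i.d. source. -/
noncomputable def codeDist [Fintype X] (PX : X → ℝ) (d : X → Y → ℝ) {n : ℕ}
    (c : Code X Y n) : ℝ :=
  ∑ xs : Fin n → X, iid PX n xs * ((1 / n : ℝ) * ∑ i, d (xs i) (c.out xs i))

/-- A good (i.e. `R(D)`-achieving) sequence of rate-distortion codes for distortion `D`. -/
def GoodRD [Fintype X] [Fintype Y] (PX : X → ℝ) (d : X → Y → ℝ) (D : ℝ)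
    (c : ∀ n, Code X Y n) : Prop :=
  Tendsto (fun n => (c n).rate) atTop (nhds (RD PX d D)) ∧
  limsup (fun n => codeDist PX d (c n)) atTop ≤ D

end RateDistortionDefs

section RateDistortionVariational

variable {X Y : Type*} [Fintype X] [Fintype Y]

/-- The information density `log (P(x,y) / (P_X(x) P_Y(y)))` of a joint distribution. -/
noncomputable def infoDensity (P : X × Y → ℝ) (x : X) (y : Y) : ℝ :=
  Real.log (P (x, y) / (margX P x * margY P y))

lemma IsPMF.sum_sum {P : X × Y → ℝ} (hP : IsPMF P) : ∑ x, ∑ y, P (x, y) = 1 := by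
  rw [← Fintype.sum_prod_type]
  exact hP.2

lemma IsPMF.sum_margX {P : X × Y → ℝ} (hP : IsPMF P) : ∑ x, margX P x = 1 :=
  hP.sum_sum

lemma IsPMF.sum_margY {P : X × Y → ℝ} (hP : IsPMF P) : ∑ y, margY P y = 1 := by
  unfold margY
  rw [Finset.sum_comm]
  exact hP.sum_sum

lemma IsPMF.of_margX {P : X × Y → ℝ} {PX : X → ℝ} (hPX : IsPMF PX) (hP : ∀ p, 0 ≤ P p)
    (h : margX P = PX) : IsPMF P := by
  refine ⟨hP, ?_⟩
  rw [Fintype.sum_prod_type, ← hPX.2, ← h]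
  rfl

lemma mutualInfo_nonneg {P : X × Y → ℝ} (hP : IsPMF P) : 0 ≤ mutualInfo P := by
  have hterm : ∀ x y, P (x, y) - margX P x * margY P y ≤
      P (x, y) * Real.log (P (x, y) / (margX P x * margY P y)) := by
    intro x y
    have hX : P (x, y) ≤ margX P x :=
      Finset.single_le_sum (f := fun y => P (x, y)) (fun y _ => hP.1 _) (Finset.mem_univ y)
    have hY : P (x, y) ≤ margY P y :=
      Finset.single_le_sum (f := fun x => P (x, y)) (fun x _ => hP.1 _) (Finset.mem_univ x)
    rcases (hP.1 (x, y)).eq_or_lt with h0 | h0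
    · rw [← h0] at hX hY ⊢
      simpa using mul_nonneg hX hY
    · have hm : 0 < margX P x * margY P y := mul_pos (h0.trans_le hX) (h0.trans_le hY)
      have hlog := Real.one_sub_inv_le_log_of_pos (div_pos h0 hm)
      calc P (x, y) - margX P x * margY P y
          = P (x, y) * (1 - (P (x, y) / (margX P x * margY P y))⁻¹) := by
            field_simp
        _ ≤ _ := mul_le_mul_of_nonneg_left hlog h0.le
  calc (0 : ℝ) = ∑ x, ∑ y, (P (x, y) - margX P x * margY P y) := by
        simp only [Finset.sum_sub_distrib, ← Finset.mul_sum, hP.sum_margY, mul_one,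
          hP.sum_sum, hP.sum_margX, sub_self]
    _ ≤ _ := Finset.sum_le_sum fun x _ => Finset.sum_le_sum fun y _ => hterm x y

lemma RD_le_mutualInfo {PX : X → ℝ} {d : X → Y → ℝ} {D : ℝ} {P : X × Y → ℝ} (hP : IsPMF P)
    (hm : margX P = PX) (hD : expDist P d ≤ D) : RD PX d D ≤ mutualInfo P := by
  refine csInf_le ⟨0, ?_⟩ ⟨P, hP, hm, hD, rfl⟩
  rintro r ⟨Q, hQ, -, -, rfl⟩
  exact mutualInfo_nonneg hQ

lemma expDist_convexComb (P q : X × Y → ℝ) (d : X → Y → ℝ) (a b : ℝ) :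
    expDist (fun p => a * P p + b * q p) d = a * expDist P d + b * expDist q d := by
  simp only [expDist, Finset.mul_sum, ← Finset.sum_add_distrib]
  exact Finset.sum_congr rfl fun x _ => Finset.sum_congr rfl fun y _ => by ring

lemma margX_convexComb {X Y : Type*} [Fintype Y] (P q : X × Y → ℝ) (a b : ℝ) (x : X) :
    margX (fun p => a * P p + b * q p) x = a * margX P x + b * margX q x := by
  simp only [margX, Finset.mul_sum, ← Finset.sum_add_distrib]

/-- Mutual information is bounded by the cross information density plus a chi-squared term. -/
lemma mutualInfo_le_expDist_infoDensity_add {P Q : X × Y → ℝ} (hP : IsPMF P) (hQ : IsPMF Q)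
    (hPpos : ∀ p, 0 < P p) (hQpos : ∀ p, 0 < Q p) (hm : margX Q = margX P) :
    mutualInfo Q ≤ expDist Q (infoDensity P) + ∑ x, ∑ y, (Q (x, y) - P (x, y)) ^ 2 / P (x, y) := by
  have hterm : ∀ x y, Q (x, y) * Real.log (Q (x, y) / (margX Q x * margY Q y)) ≤
      Q (x, y) * infoDensity P x y + (Q (x, y) - P (x, y)) ^ 2 / P (x, y)
        + ((Q (x, y) - P (x, y)) + (Q (x, y) * (margY P y / margY Q y) - Q (x, y))) := by
    intro x y
    have hp := hPpos (x, y)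
    have hq := hQpos (x, y)
    have hX : 0 < margX P x := Finset.sum_pos (fun y _ => hPpos _) ⟨y, Finset.mem_univ y⟩
    have hY : 0 < margY P y := Finset.sum_pos (fun y _ => hPpos _) ⟨x, Finset.mem_univ x⟩
    have hY' : 0 < margY Q y := Finset.sum_pos (fun y _ => hQpos _) ⟨x, Finset.mem_univ x⟩
    have h1 := Real.log_le_sub_one_of_pos (div_pos hq hp)
    have h2 := Real.log_le_sub_one_of_pos (div_pos hY hY')
    have heq : Real.log (Q (x, y) / (margX Q x * margY Q y)) =
        infoDensity P x y + Real.log (Q (x, y) / P (x, y))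
          + Real.log (margY P y / margY Q y) := by
      rw [infoDensity, hm, ← Real.log_mul (by positivity) (by positivity),
        ← Real.log_mul (by positivity) (by positivity)]
      congr 1
      field_simp
    calc _ ≤ Q (x, y) * (infoDensity P x y + (Q (x, y) / P (x, y) - 1)
            + (margY P y / margY Q y - 1)) := by
          rw [heq]
          gcongr
      _ = _ := by
          field_simp
          ring
  have hcross : ∑ x, ∑ y, Q (x, y) * (margY P y / margY Q y) = 1 := by
    rw [Finset.sum_comm, ← hP.sum_margY]
    refine Finset.sum_congr rfl fun y _ => ?_
    rw [← Finset.sum_mul]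
    have hX : Nonempty X := by
      by_contra h
      rw [not_nonempty_iff] at h
      simpa using hP.2
    have hY' : 0 < margY Q y := Finset.sum_pos (fun y _ => hQpos _) Finset.univ_nonempty
    exact mul_div_cancel₀ _ hY'.ne'
  calc mutualInfo Q ≤ _ :=
        Finset.sum_le_sum fun x _ => Finset.sum_le_sum fun y _ => hterm x y
    _ = _ := by
        simp only [Finset.sum_add_distrib, Finset.sum_sub_distrib, hcross, hP.sum_sum, hQ.sum_sum,
          expDist]
        ring

/-- First-order optimality of a fully supported minimizer of the rate-distortion function. -/
lemma IsRDMinimizer.RD_le_expDist_infoDensity {PX : X → ℝ} {d : X → Y → ℝ} {D : ℝ}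
    {P q : X × Y → ℝ} (hPX : IsPMF PX) (hP : IsRDMinimizer PX d D P) (hpos : ∀ p, 0 < P p)
    (hq : ∀ p, 0 ≤ q p) (hqX : margX q = PX) (hqD : expDist q d ≤ D) :
    RD PX d D ≤ expDist q (infoDensity P) := by
  obtain ⟨hPpmf, hPm, hPD, hPI⟩ := hP
  set C := ∑ x, ∑ y, (q (x, y) - P (x, y)) ^ 2 / P (x, y) with hC
  have hself : expDist P (infoDensity P) = RD PX d D := hPI
  have hbound : ∀ t : ℝ, 0 < t → t < 1 →
      RD PX d D ≤ expDist q (infoDensity P) + C * t := by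
    intro t ht0 ht1
    set Q : X × Y → ℝ := fun p => (1 - t) * P p + t * q p with hQdef
    have hQpos : ∀ p, 0 < Q p := fun p =>
      add_pos_of_pos_of_nonneg (mul_pos (by linarith) (hpos p)) (mul_nonneg ht0.le (hq p))
    have hQm : margX Q = PX := by
      ext x
      rw [hQdef, margX_convexComb, hPm, hqX]
      ring
    have hQpmf : IsPMF Q := IsPMF.of_margX hPX (fun p => (hQpos p).le) hQm
    have hQD : expDist Q d ≤ D := by
      rw [hQdef, expDist_convexComb]
      nlinarith
    have h1 := RD_le_mutualInfo hQpmf hQm hQD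
    have h2 := mutualInfo_le_expDist_infoDensity_add hPpmf hQpmf hpos hQpos (hQm.trans hPm.symm)
    have h3 : ∑ x, ∑ y, (Q (x, y) - P (x, y)) ^ 2 / P (x, y) = t ^ 2 * C := by
      simp only [hC, Finset.mul_sum]
      refine Finset.sum_congr rfl fun x _ => Finset.sum_congr rfl fun y _ => ?_
      simp only [hQdef]
      ring
    rw [h3, hQdef, expDist_convexComb, hself] at h2
    have h4 : t * RD PX d D ≤ t * (expDist q (infoDensity P) + C * t) := by
      linear_combination h1.trans h2
    exact le_of_mul_le_mul_left h4 ht0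
  have hlim : Tendsto (fun t : ℝ => expDist q (infoDensity P) + C * t)
      (nhdsWithin 0 (Set.Ioi 0)) (nhds (expDist q (infoDensity P))) := by
    have : Continuous fun t : ℝ => expDist q (infoDensity P) + C * t := by fun_prop
    simpa using (this.tendsto 0).mono_left nhdsWithin_le_nhds
  refine ge_of_tendsto hlim ?_
  filter_upwards [Ioo_mem_nhdsGT (zero_lt_one (α := ℝ))] with t ht
  exact hbound t ht.1 ht.2

/-- When the distortion constraint is violated by at most `e`, first-order optimality degrades
linearly in `e`; the slope is controlled by a joint distribution `q₀` of zero distortion. -/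
lemma IsRDMinimizer.RD_sub_le_expDist_infoDensity {PX : X → ℝ} {d : X → Y → ℝ} {D e : ℝ}
    {P q q₀ : X × Y → ℝ} (hPX : IsPMF PX) (hP : IsRDMinimizer PX d D P) (hpos : ∀ p, 0 < P p)
    (hD : 0 < D) (he : 0 ≤ e)
    (hq₀ : ∀ p, 0 ≤ q₀ p) (hq₀X : margX q₀ = PX) (hq₀D : expDist q₀ d = 0)
    (hq : ∀ p, 0 ≤ q p) (hqX : margX q = PX) (hqD : expDist q d ≤ D + e) :
    RD PX d D - e * ((expDist q₀ (infoDensity P) - RD PX d D) / D) ≤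
      expDist q (infoDensity P) := by
  have hDe : 0 < D + e := by linarith
  have h := hP.RD_le_expDist_infoDensity (q := fun p => D / (D + e) * q p + e / (D + e) * q₀ p)
    hPX hpos
    (fun p => add_nonneg (mul_nonneg (by positivity) (hq p)) (mul_nonneg (by positivity) (hq₀ p)))
    (by
      ext x
      rw [margX_convexComb, hqX, hq₀X]
      field_simp)
    (by
      rw [expDist_convexComb, hq₀D, mul_zero, add_zero]
      calc D / (D + e) * expDist q d ≤ D / (D + e) * (D + e) := by gcongr
        _ = D := by field_simp)
  rw [expDist_convexComb, div_mul_eq_mul_div, div_mul_eq_mul_div, ← add_div, le_div_iff₀ hDe] at h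
  rw [mul_div_assoc', sub_le_iff_le_add, ← sub_le_iff_le_add', le_div_iff₀ hD]
  linarith

lemma exists_zero_expDist [Nonempty Y] {PX : X → ℝ} (hPXfull : ∀ x, 0 < PX x) {d : X → Y → ℝ}
    (hd : ∀ x y, 0 ≤ d x y)
    (hdmin : ∑ x, PX x * (Finset.univ.inf' Finset.univ_nonempty fun y => d x y) = 0) :
    ∃ q : X × Y → ℝ, (∀ p, 0 ≤ q p) ∧ margX q = PX ∧ expDist q d = 0 := by
  have hex : ∀ x, ∃ y, d x y = 0 := by
    intro x
    have hnn : ∀ x, 0 ≤ Finset.univ.inf' Finset.univ_nonempty fun y => d x y := fun x =>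
      Finset.le_inf' _ _ fun y _ => hd x y
    have h := (Finset.sum_eq_zero_iff_of_nonneg fun x _ =>
      mul_nonneg (hPXfull x).le (hnn x)).1 hdmin x (Finset.mem_univ x)
    obtain ⟨y, -, hy⟩ := Finset.exists_mem_eq_inf' Finset.univ_nonempty fun y => d x y
    exact ⟨y, hy ▸ (mul_eq_zero.1 h).resolve_left (hPXfull x).ne'⟩
  choose φ hφ using hex
  refine ⟨fun p => if p.2 = φ p.1 then PX p.1 else 0, fun p => ?_, ?_, ?_⟩
  · dsimp only
    split_ifs
    exacts [(hPXfull _).le, le_rfl]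
  · ext x
    simp [margX]
  · simp [expDist, ite_mul, hφ]

end RateDistortionVariational

section CodeJoint

variable {X Y : Type*} [Fintype X] {n : ℕ}

lemma iid_nonneg {X : Type*} {n : ℕ} {PX : X → ℝ} (hPX : ∀ x, 0 ≤ PX x) (xs : Fin n → X) : 0 ≤ iid PX n xs :=
  Finset.prod_nonneg fun _ _ => hPX _

lemma sum_iid {PX : X → ℝ} (hPX : IsPMF PX) : ∑ xs, iid PX n xs = 1 := by
  have h := Finset.prod_univ_sum (fun _ : Fin n => (Finset.univ : Finset X)) fun _ a => PX a
  rw [Fintype.piFinset_univ] at h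
  simp only [iid]
  rw [← h, hPX.2, Finset.prod_const_one]

lemma sum_iid_mul_apply {PX : X → ℝ} (hPX : IsPMF PX) (i : Fin n) (g : X → ℝ) :
    ∑ xs, iid PX n xs * g (xs i) = ∑ x, PX x * g x := by
  have h := Finset.prod_univ_sum (fun _ : Fin n => (Finset.univ : Finset X))
    fun j a => PX a * if j = i then g a else 1
  rw [Fintype.piFinset_univ] at h
  have hr : ∀ xs : Fin n → X, ∏ j, PX (xs j) * (if j = i then g (xs j) else 1) =
      iid PX n xs * g (xs i) := fun xs => by
    rw [Finset.prod_mul_distrib]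
    simp [iid]
  simp only [hr] at h
  rw [← h, Finset.prod_eq_single i]
  · simp
  · intro j _ hj
    simp [hj, hPX.2]
  · simp

/-- The time-averaged single-letter joint distribution induced by a code. -/
noncomputable def averageJoint (PX : X → ℝ) (c : Code X Y n) : X × Y → ℝ :=
  fun p => ∑ xs : Fin n → X, iid PX n xs *
    ((1 / n : ℝ) * ∑ i, if (xs i, c.out xs i) = p then 1 else 0)

lemma averageJoint_nonneg {PX : X → ℝ} (hPX : IsPMF PX) (c : Code X Y n) (p : X × Y) :
    0 ≤ averageJoint PX c p :=
  Finset.sum_nonneg fun xs _ => mul_nonneg (iid_nonneg hPX.1 xs) <|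
    mul_nonneg (by positivity) <| Finset.sum_nonneg fun i _ => by positivity

lemma codeDist_fst {PX : X → ℝ} (hPX : IsPMF PX) (hn : n ≠ 0) (c : Code X Y n) (g : X → ℝ) :
    codeDist PX (fun x _ => g x) c = ∑ x, PX x * g x := by
  simp only [codeDist, mul_left_comm _ (1 / n : ℝ), ← Finset.mul_sum]
  simp only [Finset.mul_sum Finset.univ (fun i : Fin n => g _)]
  rw [Finset.sum_comm]
  simp only [sum_iid_mul_apply hPX, Finset.sum_const, Finset.card_univ, Fintype.card_fin,
    nsmul_eq_mul]
  field_simp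

lemma approxJoint_out_pos [DecidableEq Y] {P : X × Y → ℝ} (hpos : ∀ p, 0 < P p) (c : Code X Y n)
    (xs : Fin n → X) : 0 < approxJoint P c (xs, c.out xs) := by
  have hM : (0 : ℝ) < c.M := by exact_mod_cast c.hM
  refine mul_pos (div_pos (Nat.cast_pos.2 (Finset.card_pos.2 ⟨c.enc xs,
      Finset.mem_filter.2 ⟨Finset.mem_univ _, rfl⟩⟩)) hM)
    (Finset.prod_pos fun i _ => div_pos (hpos _)
      (Finset.sum_pos (fun x _ => hpos _) ⟨xs i, Finset.mem_univ _⟩))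

variable [Fintype Y]

lemma expDist_averageJoint (PX : X → ℝ) (c : Code X Y n) (g : X → Y → ℝ) :
    expDist (averageJoint PX c) g = codeDist PX g c := by
  have h : expDist (averageJoint PX c) g = ∑ p : X × Y, averageJoint PX c p * g p.1 p.2 :=
    (Fintype.sum_prod_type fun p : X × Y => averageJoint PX c p * g p.1 p.2).symm
  rw [h]
  simp only [averageJoint, codeDist, Finset.sum_mul]
  rw [Finset.sum_comm]
  refine Finset.sum_congr rfl fun xs _ => ?_
  simp only [mul_assoc, ← Finset.mul_sum, Finset.sum_mul]
  rw [Finset.sum_comm]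
  simp

lemma margX_averageJoint {PX : X → ℝ} (hPX : IsPMF PX) (hn : n ≠ 0) (c : Code X Y n) :
    margX (averageJoint PX c) = PX := by
  ext x
  have h := (expDist_averageJoint PX c fun a _ => if a = x then 1 else 0).trans
    (codeDist_fst hPX hn c fun a => if a = x then 1 else 0)
  simpa [expDist, margX, ← Finset.sum_mul] using h

lemma codeDist_le {PX : X → ℝ} (hPX : IsPMF PX) {d : X → Y → ℝ} (hd : ∀ x y, 0 ≤ d x y)
    (c : Code X Y n) : codeDist PX d c ≤ ∑ x, ∑ y, d x y := by
  have hle : ∀ x y, d x y ≤ ∑ x, ∑ y, d x y := fun x y =>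
    (Finset.single_le_sum (f := fun y => d x y) (fun y _ => hd x y) (Finset.mem_univ y)).trans
      (Finset.single_le_sum (f := fun x => ∑ y, d x y)
        (fun x _ => Finset.sum_nonneg fun y _ => hd x y) (Finset.mem_univ x))
  have hS : 0 ≤ ∑ x, ∑ y, d x y := Finset.sum_nonneg fun x _ => Finset.sum_nonneg fun y _ => hd x y
  calc codeDist PX d c ≤ ∑ xs : Fin n → X, iid PX n xs * ∑ x, ∑ y, d x y := by
        refine Finset.sum_le_sum fun xs _ => mul_le_mul_of_nonneg_left ?_ (iid_nonneg hPX.1 xs)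
        rcases eq_or_ne n 0 with rfl | hn
        · simpa using hS
        · calc _ ≤ (1 / n : ℝ) * ∑ _i : Fin n, ∑ x, ∑ y, d x y := by
                gcongr
                exact hle _ _
            _ = _ := by
                simp only [Finset.sum_const, Finset.card_univ, Fintype.card_fin, nsmul_eq_mul]
                field_simp
    _ = _ := by rw [← Finset.sum_mul, sum_iid hPX, one_mul]

variable [DecidableEq Y]

/-- Pointwise bound on the log-likelihood ratio between the induced and approximating joint
distributions along the code. -/
lemma log_iid_div_approxJoint_le {PX : X → ℝ} (hPXfull : ∀ x, 0 < PX x) {P : X × Y → ℝ}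
    (hpos : ∀ p, 0 < P p) (hm : margX P = PX) (c : Code X Y n) (xs : Fin n → X) :
    Real.log (iid PX n xs / approxJoint P c (xs, c.out xs)) ≤
      Real.log c.M - ∑ i, infoDensity P (xs i) (c.out xs i) := by
  have hM : (0 : ℝ) < c.M := by exact_mod_cast c.hM
  have hYpos : ∀ i, 0 < margY P (c.out xs i) := fun i =>
    Finset.sum_pos (fun x _ => hpos _) ⟨xs i, Finset.mem_univ _⟩
  have hcond : ∀ i, 0 < condXY P (xs i) (c.out xs i) := fun i => div_pos (hpos _) (hYpos i)
  have hprod : 0 < ∏ i, condXY P (xs i) (c.out xs i) := Finset.prod_pos fun i _ => hcond i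
  have hiid : 0 < iid PX n xs := Finset.prod_pos fun i _ => hPXfull _
  have hlow : 1 / c.M * ∏ i, condXY P (xs i) (c.out xs i) ≤ approxJoint P c (xs, c.out xs) := by
    refine mul_le_mul_of_nonneg_right ?_ hprod.le
    gcongr
    rw [Nat.one_le_cast, Nat.one_le_iff_ne_zero, Finset.card_ne_zero]
    exact ⟨c.enc xs, Finset.mem_filter.2 ⟨Finset.mem_univ _, rfl⟩⟩
  calc Real.log (iid PX n xs / approxJoint P c (xs, c.out xs))
      ≤ Real.log (iid PX n xs / (1 / c.M * ∏ i, condXY P (xs i) (c.out xs i))) := by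
        have := approxJoint_out_pos hpos c xs
        gcongr
    _ = Real.log c.M - ∑ i, (Real.log (condXY P (xs i) (c.out xs i)) - Real.log (PX (xs i))) := by
        rw [Real.log_div hiid.ne' (by positivity), Real.log_mul (by positivity) hprod.ne', iid,
          Real.log_prod fun i _ => (hPXfull _).ne', Real.log_prod fun i _ => (hcond i).ne',
          one_div, Real.log_inv, Finset.sum_sub_distrib]
        ring
    _ = _ := by
        congr 1
        refine Finset.sum_congr rfl fun i _ => ?_
        rw [← Real.log_div (hcond i).ne' (hPXfull _).ne', infoDensity, hm, condXY, div_div,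
          mul_comm]

lemma relEnt_inducedJoint_approxJoint_div_le {PX : X → ℝ} (hPX : IsPMF PX)
    (hPXfull : ∀ x, 0 < PX x) {P : X × Y → ℝ} (hpos : ∀ p, 0 < P p) (hm : margX P = PX)
    (hn : n ≠ 0) (c : Code X Y n) :
    relEnt (inducedJoint PX c) (approxJoint P c) / n ≤
      ENNReal.ofReal (c.rate - codeDist PX (infoDensity P) c) := by
  have hn' : (0 : ℝ) < n := by positivity
  have hac : ∀ p, approxJoint P c p = 0 → inducedJoint PX c p = 0 := by
    rintro ⟨xs, ys⟩ h
    by_cases hy : ys = c.out xs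
    · subst hy
      exact absurd h (approxJoint_out_pos hpos c xs).ne'
    · simp [inducedJoint, hy]
  have hsum : ∑ p, inducedJoint PX c p * Real.log (inducedJoint PX c p / approxJoint P c p) =
      ∑ xs, iid PX n xs * Real.log (iid PX n xs / approxJoint P c (xs, c.out xs)) := by
    rw [Fintype.sum_prod_type]
    refine Finset.sum_congr rfl fun xs _ => ?_
    rw [Finset.sum_eq_single (c.out xs)]
    · simp [inducedJoint, iid]
    · intro ys _ hy
      simp [inducedJoint, hy]
    · simp
  rw [relEnt, if_pos hac, hsum, ← ENNReal.ofReal_natCast n, ← ENNReal.ofReal_div_of_pos hn']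
  refine ENNReal.ofReal_le_ofReal ?_
  rw [div_le_iff₀ hn']
  calc _ ≤ ∑ xs, iid PX n xs * (Real.log c.M - ∑ i, infoDensity P (xs i) (c.out xs i)) :=
        Finset.sum_le_sum fun xs _ => mul_le_mul_of_nonneg_left
          (log_iid_div_approxJoint_le hPXfull hpos hm c xs) (iid_nonneg hPX.1 xs)
    _ = _ := by
        simp only [mul_sub, Finset.sum_sub_distrib, ← Finset.sum_mul, sum_iid hPX, codeDist,
          Code.rate, mul_left_comm _ (1 / n : ℝ), ← Finset.mul_sum]
        field_simp

end CodeJoint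

/-- **Theorem 4.** Let `D > 0` and assume the reproduction alphabet has been reduced to
`𝒴*(D)`, i.e. every minimizer of `R(D)` has full support on `𝒳 × 𝒴`. Then for any good
(`R(D)`-achieving) sequence of rate-distortion codes and any minimizer `PXY` of `R(D)`
(whose backward channel `P_{X|Y}` is unique), the normalized relative entropy between
the code-induced joint distribution and the approximating distribution vanishes. -/
theorem good_rate_distortion_codes_backward_dmc
    {X Y : Type*} [Fintype X] [Fintype Y] [DecidableEq X] [DecidableEq Y] [Nonempty Y]
    (PX : X → ℝ) (hPX : IsPMF PX) (hPXfull : ∀ x, 0 < PX x)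
    (d : X → Y → ℝ) (hd : ∀ x y, 0 ≤ d x y)
    (hdmin : ∑ x, PX x * (Finset.univ.inf' Finset.univ_nonempty fun y => d x y) = 0)
    (D : ℝ) (hD : 0 < D)
    (hreduced : ∀ P : X × Y → ℝ, IsRDMinimizer PX d D P → ∀ x y, 0 < P (x, y))
    (c : ∀ n, Code X Y n) (hgood : GoodRD PX d D c) :
    ∀ PXY : X × Y → ℝ, IsRDMinimizer PX d D PXY →
      Tendsto
        (fun n => relEnt (inducedJoint PX (c n)) (approxJoint PXY (c n)) / (n : ℝ≥0∞))
        atTop (nhds 0) := by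
  intro PXY hmin
  have hpos : ∀ p, 0 < PXY p := fun p => hreduced PXY hmin p.1 p.2
  obtain ⟨hrate, hlimsup⟩ := hgood
  obtain ⟨q₀, hq₀, hq₀X, hq₀D⟩ := exists_zero_expDist hPXfull hd hdmin
  set e : ℕ → ℝ := fun n => max 0 (codeDist PX d (c n) - D)
  have he : Tendsto e atTop (nhds 0) := by
    rw [Metric.tendsto_atTop']
    intro ε hε
    have hbdd : IsBoundedUnder (· ≤ ·) atTop fun n => codeDist PX d (c n) :=
      isBoundedUnder_of ⟨_, fun n => codeDist_le hPX hd (c n)⟩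
    have hev : ∀ᶠ n in atTop, codeDist PX d (c n) < D + ε :=
      eventually_lt_of_limsup_lt (by linarith) hbdd
    obtain ⟨N, hN⟩ := eventually_atTop.1 hev
    refine ⟨N, fun n hn => ?_⟩
    rw [Real.dist_0_eq_abs, abs_of_nonneg (le_max_left _ _)]
    exact max_lt hε (by linarith [hN n hn.le])
  set K := (expDist q₀ (infoDensity PXY) - RD PX d D) / D
  have hlim : Tendsto (fun n => ENNReal.ofReal ((c n).rate - (RD PX d D - e n * K)))
      atTop (nhds 0) := by
    have h := hrate.sub (tendsto_const_nhds (x := RD PX d D) |>.sub (he.mul_const K))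
    simpa using ENNReal.tendsto_ofReal h
  refine tendsto_of_tendsto_of_tendsto_of_le_of_le' tendsto_const_nhds hlim
    (Eventually.of_forall fun n => zero_le) ?_
  filter_upwards [eventually_ne_atTop 0] with n hn
  refine (relEnt_inducedJoint_approxJoint_div_le hPX hPXfull hpos hmin.2.1 hn (c n)).trans
    (ENNReal.ofReal_le_ofReal (sub_le_sub_left ?_ _))
  rw [← expDist_averageJoint]
  refine hmin.RD_sub_le_expDist_infoDensity hPX hpos hD (le_max_left _ _) hq₀ hq₀X hq₀D
    (averageJoint_nonneg hPX (c n)) (margX_averageJoint hPX hn (c n)) ?_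
  rw [expDist_averageJoint]
  linarith [le_max_right 0 (codeDist PX d (c n) - D)]
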